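/- (Communication-rate converse inequality.) For any n, any (R₀,R,n) coordination scheme, and any adversary strategy, with (X^n,K,J,Y^n,Z^n) distributed according to the induced joint pmf, the entropy of the message satisfies H(J) ≥ Σ_{i=1}^n I(X_i ; J, K, X^{i-1}, Y^{i-1}, Z^{i-1}). In particular, since J takes at most 2^{nR} values, nR ≥ Σ_{i=1}^n I(X_i ; J, K, X^{i-1}, Y^{i-1}, Z^{i-1}). -/

import Mathlib

open scoped BigOperators Classical

noncomputable section

/-! ### Finite probability basics -/

/-- A probability mass function on a finite type, given as a real-valued function. -/
def IsPMF {α : Type} [Fintype α] (p : α → ℝ) : Prop :=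
  (∀ a, 0 ≤ p a) ∧ ∑ a, p a = 1

/-- The probability that the random variable `A` takes the value `a` under the pmf `p`. -/
def probOf {Ω : Type} {α : Type} [Fintype Ω] (p : Ω → ℝ) (A : Ω → α) (a : α) : ℝ :=
  ∑ ω, if A ω = a then p ω else 0

/-- Shannon entropy (in bits) of the random variable `A` under the pmf `p`. -/
def entropy {Ω α : Type} [Fintype Ω] [Fintype α] (p : Ω → ℝ) (A : Ω → α) : ℝ :=
  -∑ a, probOf p A a * Real.logb 2 (probOf p A a)

/-- Conditional Shannon entropy `H(A | C)` (in bits). -/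
def condEntropy {Ω α γ : Type} [Fintype Ω] [Fintype α] [Fintype γ]
    (p : Ω → ℝ) (A : Ω → α) (C : Ω → γ) : ℝ :=
  entropy p (fun ω => (A ω, C ω)) - entropy p C

/-- Shannon mutual information `I(A;B)` (in bits). -/
def mutualInfo {Ω α β : Type} [Fintype Ω] [Fintype α] [Fintype β]
    (p : Ω → ℝ) (A : Ω → α) (B : Ω → β) : ℝ :=
  entropy p A + entropy p B - entropy p (fun ω => (A ω, B ω))

/-- Conditional Shannon mutual information `I(A;B|C)` (in bits). -/
def condMutualInfo {Ω α β γ : Type} [Fintype Ω] [Fintype α] [Fintype β] [Fintype γ]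
    (p : Ω → ℝ) (A : Ω → α) (B : Ω → β) (C : Ω → γ) : ℝ :=
  entropy p (fun ω => (A ω, C ω)) + entropy p (fun ω => (B ω, C ω))
    - entropy p (fun ω => (A ω, B ω, C ω)) - entropy p C

/-- Conditional independence `A ⟂ B | C` under the pmf `p`:
`P(A=a, B=b, C=c) · P(C=c) = P(A=a, C=c) · P(B=b, C=c)` for all `a, b, c`. -/
def CondIndep {Ω α β γ : Type} [Fintype Ω] (p : Ω → ℝ)
    (A : Ω → α) (B : Ω → β) (C : Ω → γ) : Prop :=
  ∀ a b c,
    probOf p (fun ω => (A ω, B ω, C ω)) (a, b, c) * probOf p C c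
      = probOf p (fun ω => (A ω, C ω)) (a, c) * probOf p (fun ω => (B ω, C ω)) (b, c)

/-! ### Coordination schemes and adversaries -/

/-- Cardinality of the secret-key alphabet: `max 1 ⌊2^{n R₀}⌋`. -/
def keyCard (R0 : ℝ) (n : ℕ) : ℕ := max 1 ⌊(2 : ℝ) ^ ((n : ℝ) * R0)⌋₊

/-- Cardinality of the message alphabet: `max 1 ⌊2^{n R}⌋`. -/
def msgCard (R : ℝ) (n : ℕ) : ℕ := max 1 ⌊(2 : ℝ) ^ ((n : ℝ) * R)⌋₊

/-- An `(R₀, R, n)` coordination scheme: a randomized encoder `p(j | xⁿ, k)` and a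
randomized causal decoder `{p(yᵢ | j, k, x^{i-1}, y^{i-1}, z^{i-1})}`. -/
structure Scheme (X Y Z : Type) [Fintype X] [Fintype Y] [Fintype Z]
    (R0 R : ℝ) (n : ℕ) where
  enc : (Fin n → X) → Fin (keyCard R0 n) → Fin (msgCard R n) → ℝ
  enc_pmf : ∀ x k, IsPMF (enc x k)
  dec : Fin n → Fin (msgCard R n) → Fin (keyCard R0 n) →
      (Fin n → X) → (Fin n → Y) → (Fin n → Z) → Y → ℝ
  dec_pmf : ∀ i j k x y z, IsPMF (dec i j k x y z)
  dec_causal : ∀ i j k x y z x' y' z',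
      (∀ m, m < i → x m = x' m) → (∀ m, m < i → y m = y' m) →
      (∀ m, m < i → z m = z' m) →
      dec i j k x y z = dec i j k x' y' z'

/-- An adversary strategy with full causal information:
`{p(zᵢ | j, x^{i-1}, y^{i-1}, z^{i-1})}`. -/
structure Adversary (X Y Z : Type) [Fintype X] [Fintype Y] [Fintype Z]
    (R : ℝ) (n : ℕ) where
  adv : Fin n → Fin (msgCard R n) →
      (Fin n → X) → (Fin n → Y) → (Fin n → Z) → Z → ℝ
  adv_pmf : ∀ i j x y z, IsPMF (adv i j x y z)
  adv_causal : ∀ i j x y z x' y' z',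
      (∀ m, m < i → x m = x' m) → (∀ m, m < i → y m = y' m) →
      (∀ m, m < i → z m = z' m) →
      adv i j x y z = adv i j x' y' z'

/-- Sample space of a block of length `n`: `(Xⁿ, K, J, Yⁿ, Zⁿ)`. -/
abbrev Outc (X Y Z : Type) (R0 R : ℝ) (n : ℕ) : Type :=
  (Fin n → X) × Fin (keyCard R0 n) × Fin (msgCard R n) × (Fin n → Y) × (Fin n → Z)

/-- The induced joint pmf of `(Xⁿ, K, J, Yⁿ, Zⁿ)`:
`p₀ⁿ(xⁿ)·|𝒦|⁻¹·p(j|xⁿ,k)·∏ᵢ p(yᵢ|j,k,x^{i-1},y^{i-1},z^{i-1})·p(zᵢ|j,x^{i-1},y^{i-1},z^{i-1})`. -/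
def jointPMF {X Y Z : Type} [Fintype X] [Fintype Y] [Fintype Z] {R0 R : ℝ} {n : ℕ}
    (p0 : X → ℝ) (S : Scheme X Y Z R0 R n) (A : Adversary X Y Z R n) :
    Outc X Y Z R0 R n → ℝ :=
  fun ω => (∏ i, p0 (ω.1 i)) * ((keyCard R0 n : ℝ))⁻¹ *
    S.enc ω.1 ω.2.1 ω.2.2.1 *
    ∏ i, S.dec i ω.2.2.1 ω.2.1 ω.1 ω.2.2.2.1 ω.2.2.2.2 (ω.2.2.2.1 i) *
      A.adv i ω.2.2.1 ω.1 ω.2.2.2.1 ω.2.2.2.2 (ω.2.2.2.2 i)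

/-- The expected average payoff `E[(1/n) Σᵢ π(Xᵢ, Yᵢ, Zᵢ)]`. -/
def avgValue {X Y Z : Type} [Fintype X] [Fintype Y] [Fintype Z] {R0 R : ℝ} {n : ℕ}
    (p0 : X → ℝ) (π : X → Y → Z → ℝ)
    (S : Scheme X Y Z R0 R n) (A : Adversary X Y Z R n) : ℝ :=
  ∑ ω : Outc X Y Z R0 R n, jointPMF p0 S A ω *
    ((n : ℝ)⁻¹ * ∑ i, π (ω.1 i) (ω.2.2.2.1 i) (ω.2.2.2.2 i))

/-- The robust achievable value `Π_{p₀}(R₀, R)`: the supremum over blocklengths and schemes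
of the least average payoff over all (fully informed) adversary strategies. -/
def robustValue {X Y Z : Type} [Fintype X] [Fintype Y] [Fintype Z]
    (p0 : X → ℝ) (π : X → Y → Z → ℝ) (R0 R : ℝ) : ℝ :=
  ⨆ (n : ℕ) (_ : 0 < n) (S : Scheme X Y Z R0 R n),
    ⨅ A : Adversary X Y Z R n, avgValue p0 π S A

/-! ### Single-letter quantities -/

/-- The single-letter joint pmf of `(X, Y, U, V)` built from the source `p₀` and a
conditional pmf `p(y,u,v|x)`. -/
def slJoint {X Y U V : Type} (p0 : X → ℝ) (w : X → Y × U × V → ℝ) :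
    X × Y × U × V → ℝ :=
  fun q => p0 q.1 * w q.1 q.2

/-- Membership in the single-letter region `𝒫_{p₀}(R₀,R)`: `p(y,u,v|x)` is a conditional pmf,
`X — (U,V) — Y` is a Markov chain, `R₀ ≥ I(X,Y;V|U)` and `R ≥ I(X;U,V)`. -/
def memP {X Y U V : Type} [Fintype X] [Fintype Y] [Fintype U] [Fintype V]
    (p0 : X → ℝ) (w : X → Y × U × V → ℝ) (R0 R : ℝ) : Prop :=
  (∀ x, IsPMF (w x)) ∧
  CondIndep (slJoint p0 w) (fun q => q.1) (fun q => q.2.1) (fun q => q.2.2) ∧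
  R0 ≥ condMutualInfo (slJoint p0 w)
      (fun q => (q.1, q.2.1)) (fun q => q.2.2.2) (fun q => q.2.2.1) ∧
  R ≥ mutualInfo (slJoint p0 w) (fun q => q.1) (fun q => q.2.2)

/-- The expected payoff `E[π(X, Y, z(U))]` when the adversary plays a function `z : U → Z`. -/
def slPayoff {X Y Z U V : Type} [Fintype X] [Fintype Y] [Fintype U] [Fintype V]
    (p0 : X → ℝ) (w : X → Y × U × V → ℝ) (π : X → Y → Z → ℝ) (z : U → Z) : ℝ :=
  ∑ q : X × Y × U × V, slJoint p0 w q * π q.1 q.2.1 (z q.2.2.1)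

/-- The single-letter value `Γ_{p₀,π}(R₀,R)`: the supremum over finite auxiliary alphabets
`𝒰, 𝒱` and conditional pmfs `p(y,u,v|x) ∈ 𝒫_{p₀}(R₀,R)` of `min_{z : 𝒰 → 𝒵} E[π(X,Y,z(U))]`. -/
def Gamma {X Y Z : Type} [Fintype X] [Fintype Y] [Fintype Z]
    (p0 : X → ℝ) (π : X → Y → Z → ℝ) (R0 R : ℝ) : ℝ :=
  sSup {v : ℝ | ∃ (U V : Type) (_ : Fintype U) (_ : Fintype V)
    (w : X → Y × U × V → ℝ), memP p0 w R0 R ∧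
    v = ⨅ z : U → Z, slPayoff p0 w π z}


/-- The strict past `x^{i-1} = (x_1, …, x_{i-1})` of a sequence. -/
def pastOf {α : Type} {n : ℕ} (x : Fin n → α) (i : Fin n) : Fin i.1 → α :=
  fun m => x (m.castLE i.2.le)

section EntropyBounds

variable {Ω α β γ : Type} [Fintype Ω]

theorem probOf_nonneg {p : Ω → ℝ} (hp : ∀ ω, 0 ≤ p ω) (A : Ω → α) (a : α) :
    0 ≤ probOf p A a :=
  Finset.sum_nonneg fun ω _ => by split_ifs <;> simp [hp]

theorem le_probOf_apply {p : Ω → ℝ} (hp : ∀ ω, 0 ≤ p ω) (A : Ω → α) (ω : Ω) :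
    p ω ≤ probOf p A (A ω) := by
  have h := Finset.single_le_sum (f := fun ω' => if A ω' = A ω then p ω' else 0)
    (fun ω' _ => by split_ifs <;> simp [hp]) (Finset.mem_univ ω)
  simpa [probOf] using h

variable [Fintype α] [Fintype β] [Fintype γ]

theorem sum_probOf_mul (p : Ω → ℝ) (A : Ω → α) (f : α → ℝ) :
    ∑ a, probOf p A a * f a = ∑ ω, p ω * f (A ω) := by
  simp only [probOf, Finset.sum_mul]
  rw [Finset.sum_comm]
  refine Finset.sum_congr rfl fun ω _ => ?_
  simp [ite_mul]

theorem sum_probOf (p : Ω → ℝ) (A : Ω → α) : ∑ a, probOf p A a = ∑ ω, p ω := by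
  simpa using sum_probOf_mul p A fun _ => 1

theorem entropy_eq_sum_neg_logb (p : Ω → ℝ) (A : Ω → α) :
    entropy p A = ∑ ω, p ω * -Real.logb 2 (probOf p A (A ω)) := by
  rw [← sum_probOf_mul p A fun a => -Real.logb 2 (probOf p A a), entropy]
  simp

/-- Entropy depends only on the partition generated by a random variable. -/
theorem entropy_congr (p : Ω → ℝ) {A : Ω → α} {B : Ω → β}
    (h : ∀ ω ω', A ω = A ω' ↔ B ω = B ω') : entropy p A = entropy p B := by
  simp only [entropy_eq_sum_neg_logb, probOf, h]

/-- Gibbs' inequality: cross-entropy bounds entropy from above. -/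
theorem entropy_le_crossEntropy {p : Ω → ℝ} (hp : IsPMF p) (A : Ω → α) (q : α → ℝ)
    (hq : ∀ a, 0 ≤ q a) (hq1 : ∑ a, q a ≤ 1) (hpq : ∀ ω, 0 < p ω → 0 < q (A ω)) :
    entropy p A ≤ ∑ ω, p ω * -Real.logb 2 (q (A ω)) := by
  rw [← sum_probOf_mul p A fun a => -Real.logb 2 (q a), entropy, ← Finset.sum_neg_distrib]
  have hlog : 0 < Real.log 2 := Real.log_pos one_lt_two
  have key : ∀ a, -(probOf p A a * Real.logb 2 (probOf p A a)) ≤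
      probOf p A a * -Real.logb 2 (q a) + (q a - probOf p A a) / Real.log 2 := by
    intro a
    rcases (probOf_nonneg hp.1 A a).eq_or_lt with h0 | h0
    · rw [← h0]
      simpa using div_nonneg (hq a) hlog.le
    · have hqa : 0 < q a := by
        by_contra hne
        have : probOf p A a = 0 := Finset.sum_eq_zero fun ω _ => by
          split_ifs with h
          · by_contra hpω
            exact hne (h ▸ hpq ω (lt_of_le_of_ne (hp.1 ω) (Ne.symm hpω)))
          · rfl
        exact h0.ne' this
      have h1 := Real.log_le_sub_one_of_pos (div_pos hqa h0)
      rw [Real.log_div hqa.ne' h0.ne'] at h1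
      have h2 := mul_le_mul_of_nonneg_left h1 h0.le
      have h3 : probOf p A a * (q a / probOf p A a - 1) = q a - probOf p A a := by
        field_simp
      rw [h3] at h2
      have h4 := div_le_div_of_nonneg_right h2 hlog.le
      have h5 : probOf p A a * (Real.log (q a) - Real.log (probOf p A a)) / Real.log 2 =
          probOf p A a * Real.logb 2 (q a) - probOf p A a * Real.logb 2 (probOf p A a) := by
        simp only [Real.logb]
        ring
      linarith
  refine (Finset.sum_le_sum fun a _ => key a).trans ?_
  rw [Finset.sum_add_distrib, ← Finset.sum_div, Finset.sum_sub_distrib, sum_probOf, hp.2]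
  have := div_nonpos_of_nonpos_of_nonneg (sub_nonpos.2 hq1) hlog.le
  linarith

/-- Conditional Gibbs inequality: a conditional subprobability `g ω`, determined by `C ω`, bounds
the conditional entropy of `V` given `C` by its cross-entropy. -/
theorem entropy_pair_sub_le {p : Ω → ℝ} (hp : IsPMF p) (C : Ω → γ) (V : Ω → β)
    (g : Ω → β → ℝ) (hg : ∀ ω v, 0 ≤ g ω v) (hg1 : ∀ ω, ∑ v, g ω v ≤ 1)
    (hgC : ∀ ω ω', C ω = C ω' → g ω = g ω') (hpg : ∀ ω, 0 < p ω → 0 < g ω (V ω)) :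
    entropy p (fun ω => (C ω, V ω)) - entropy p C ≤
      ∑ ω, p ω * -Real.logb 2 (g ω (V ω)) := by
  let q : γ → β → ℝ := fun c v => if h : ∃ ω, C ω = c then g h.choose v else 0
  have hqg : ∀ ω, q (C ω) = g ω := by
    intro ω
    have h : ∃ ω', C ω' = C ω := ⟨ω, rfl⟩
    funext v
    simp only [q, dif_pos h]
    rw [hgC _ _ h.choose_spec]
  have hq : ∀ c v, 0 ≤ q c v := by
    intro c v
    simp only [q]
    split_ifs <;> simp [hg]
  have hq1 : ∀ c, ∑ v, q c v ≤ 1 := by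
    intro c
    simp only [q]
    split_ifs <;> simp [hg1]
  have hC : ∀ ω, 0 < p ω → 0 < probOf p C (C ω) := fun ω h =>
    h.trans_le (le_probOf_apply hp.1 C ω)
  have h := entropy_le_crossEntropy hp (fun ω => (C ω, V ω))
    (fun cv => probOf p C cv.1 * q cv.1 cv.2)
    (fun cv => mul_nonneg (probOf_nonneg hp.1 C _) (hq _ _))
    (by
      rw [Fintype.sum_prod_type]
      simp only [← Finset.mul_sum]
      calc ∑ c, probOf p C c * ∑ v, q c v ≤ ∑ c, probOf p C c * 1 :=
            Finset.sum_le_sum fun c _ =>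
              mul_le_mul_of_nonneg_left (hq1 c) (probOf_nonneg hp.1 C c)
        _ = 1 := by simp only [mul_one]; rw [sum_probOf, hp.2]
        _ ≤ 1 := le_rfl)
    (fun ω hω => mul_pos (hC ω hω) (by simpa [hqg] using hpg ω hω))
  rw [entropy_eq_sum_neg_logb p C, sub_le_iff_le_add, ← Finset.sum_add_distrib]
  refine h.trans (Finset.sum_le_sum fun ω _ => ?_)
  rcases (hp.1 ω).eq_or_lt with h0 | h0
  · simp [← h0]
  · simp only [hqg]
    rw [Real.logb_mul (hC ω h0).ne' (hpg ω h0).ne']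
    exact le_of_eq (by ring)

theorem entropy_le_logb_card [Nonempty α] {p : Ω → ℝ} (hp : IsPMF p) (A : Ω → α) :
    entropy p A ≤ Real.logb 2 (Fintype.card α) := by
  have hc : (0 : ℝ) < Fintype.card α := by exact_mod_cast Fintype.card_pos
  have h := entropy_le_crossEntropy hp A (fun _ => (Fintype.card α : ℝ)⁻¹)
    (fun _ => (inv_pos.2 hc).le) (by simp [hc.ne']) (fun _ _ => inv_pos.2 hc)
  simpa [Real.logb_inv, ← Finset.sum_mul, hp.2] using h

theorem entropy_pair_le_add_logb_card [Nonempty β] {p : Ω → ℝ} (hp : IsPMF p)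
    (A : Ω → α) (B : Ω → β) :
    entropy p (fun ω => (A ω, B ω)) ≤ entropy p A + Real.logb 2 (Fintype.card β) := by
  have hc : (0 : ℝ) < Fintype.card β := by exact_mod_cast Fintype.card_pos
  have h := entropy_pair_sub_le hp A B (fun _ _ => (Fintype.card β : ℝ)⁻¹)
    (fun _ _ => (inv_pos.2 hc).le) (by simp [hc.ne']) (fun _ _ _ => rfl)
    (fun _ _ => inv_pos.2 hc)
  simp only [Real.logb_inv, neg_neg, ← Finset.sum_mul, hp.2] at h
  linarith

end EntropyBounds

/-- The product of causal conditional pmfs is a pmf on sequences. -/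
theorem sum_prod_causal_eq_one {U : Type} [Fintype U] {n : ℕ}
    (q : Fin n → (Fin n → U) → U → ℝ) (hne : Nonempty (Fin n → U))
    (hq : ∀ i u, ∑ v, q i u v = 1)
    (hc : ∀ i u u', (∀ m, m < i → u m = u' m) → q i u = q i u') :
    ∑ u : Fin n → U, ∏ i, q i u (u i) = 1 := by
  induction n with
  | zero => simp
  | succ n ih =>
    obtain ⟨u₀⟩ := hne
    rw [← (Fin.consEquiv fun _ => U).sum_comp, Fintype.sum_prod_type]
    have h : ∀ a : U, ∑ u : Fin n → U,
        ∏ i, q i (Fin.consEquiv (fun _ => U) (a, u)) (Fin.consEquiv (fun _ => U) (a, u) i) =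
          q 0 u₀ a := by
      intro a
      have h0 : ∀ u, q 0 (Fin.consEquiv (fun _ => U) (a, u)) = q 0 u₀ := fun u =>
        hc _ _ _ fun m hm => absurd hm (Fin.not_lt_zero m)
      simp only [Fin.prod_univ_succ, h0, Fin.consEquiv_apply, Fin.cons_zero, Fin.cons_succ]
      rw [← Finset.mul_sum]
      have := ih (fun i u => q i.succ (Fin.cons a u)) ⟨Fin.tail u₀⟩ (fun i u => hq _ _)
        (fun i u u' huu => hc _ _ _ fun m hm => by
          cases m using Fin.cases with
          | zero => rfl
          | succ m => simpa using huu m (Fin.succ_lt_succ_iff.1 hm))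
      exact (congrArg _ this).trans (mul_one _)
    simp only [h, hq]

section History

variable {X Y Z : Type} {R0 R : ℝ} {n : ℕ}

/-- The message, the key, and the first `t` letters of every sequence. -/
def history (t : ℕ) (ω : Outc X Y Z R0 R n) :
    Fin (msgCard R n) × Fin (keyCard R0 n) × (Fin n → Option (X × Y × Z)) :=
  (ω.2.2.1, ω.2.1, fun m => if m.1 < t then some (ω.1 m, ω.2.2.2.1 m, ω.2.2.2.2 m) else none)

theorem history_eq_iff (t : ℕ) (ω ω' : Outc X Y Z R0 R n) :
    history t ω = history t ω' ↔ ω.2.2.1 = ω'.2.2.1 ∧ ω.2.1 = ω'.2.1 ∧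
      ∀ m : Fin n, m.1 < t → ω.1 m = ω'.1 m ∧ ω.2.2.2.1 m = ω'.2.2.2.1 m ∧
        ω.2.2.2.2 m = ω'.2.2.2.2 m := by
  simp only [history, Prod.mk.injEq, funext_iff]
  refine and_congr_right fun _ => and_congr_right fun _ => forall_congr' fun m => ?_
  by_cases hm : m.1 < t <;> simp [hm]

theorem pastOf_eq_iff {α : Type} (x x' : Fin n → α) (i : Fin n) :
    pastOf x i = pastOf x' i ↔ ∀ m : Fin n, m.1 < i.1 → x m = x' m := by
  simp only [funext_iff, pastOf]
  exact ⟨fun h m hm => h ⟨m.1, hm⟩, fun h m => h _ m.2⟩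

theorem pastObservation_eq_iff (i : Fin n) (ω ω' : Outc X Y Z R0 R n) :
    (ω.2.2.1, ω.2.1, pastOf ω.1 i, pastOf ω.2.2.2.1 i, pastOf ω.2.2.2.2 i) =
        (ω'.2.2.1, ω'.2.1, pastOf ω'.1 i, pastOf ω'.2.2.2.1 i, pastOf ω'.2.2.2.2 i) ↔
      history i.1 ω = history i.1 ω' := by
  simp only [history_eq_iff, Prod.mk.injEq, pastOf_eq_iff]
  grind

theorem history_succ_eq_iff (i : Fin n) (ω ω' : Outc X Y Z R0 R n) :
    history (i.1 + 1) ω = history (i.1 + 1) ω' ↔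
      ((ω.1 i, history i.1 ω), (ω.2.2.2.1 i, ω.2.2.2.2 i)) =
        ((ω'.1 i, history i.1 ω'), (ω'.2.2.2.1 i, ω'.2.2.2.2 i)) := by
  simp only [Prod.mk.injEq, history_eq_iff]
  constructor
  · rintro ⟨hj, hk, h⟩
    have hi := h i (Nat.lt_succ_self _)
    exact ⟨⟨hi.1, hj, hk, fun m hm => h m (hm.trans (Nat.lt_succ_self _))⟩, hi.2⟩
  · rintro ⟨⟨hx, hj, hk, h⟩, hyz⟩
    refine ⟨hj, hk, fun m hm => ?_⟩
    rcases Nat.lt_succ_iff_lt_or_eq.1 hm with hlt | heq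
    · exact h m hlt
    · rw [Fin.ext heq]
      exact ⟨hx, hyz⟩

end History

section Scheme

variable {X Y Z : Type} [Fintype X] [Fintype Y] [Fintype Z] {R0 R : ℝ} {n : ℕ}

theorem keyCard_pos (R0 : ℝ) (n : ℕ) : 0 < keyCard R0 n := by simp [keyCard]

theorem msgCard_pos (R : ℝ) (n : ℕ) : 0 < msgCard R n := by simp [msgCard]

theorem logb_msgCard_le (hR : 0 ≤ R) : Real.logb 2 (msgCard R n) ≤ n * R := by
  rw [Real.logb_le_iff_le_rpow one_lt_two (by exact_mod_cast msgCard_pos R n), msgCard,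
    Nat.cast_max]
  refine max_le ?_ (Nat.floor_le (by positivity))
  simpa using Real.one_le_rpow one_le_two (by positivity)

/-- The conditional pmf of `(Yᵢ, Zᵢ)` given the message, the key and the past. -/
def stepPMF (S : Scheme X Y Z R0 R n) (A : Adversary X Y Z R n) (i : Fin n)
    (ω : Outc X Y Z R0 R n) (v : Y × Z) : ℝ :=
  S.dec i ω.2.2.1 ω.2.1 ω.1 ω.2.2.2.1 ω.2.2.2.2 v.1 *
    A.adv i ω.2.2.1 ω.1 ω.2.2.2.1 ω.2.2.2.2 v.2

theorem stepPMF_nonneg (S : Scheme X Y Z R0 R n) (A : Adversary X Y Z R n) (i : Fin n)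
    (ω : Outc X Y Z R0 R n) (v : Y × Z) : 0 ≤ stepPMF S A i ω v :=
  mul_nonneg ((S.dec_pmf _ _ _ _ _ _).1 _) ((A.adv_pmf _ _ _ _ _).1 _)

theorem sum_stepPMF (S : Scheme X Y Z R0 R n) (A : Adversary X Y Z R n) (i : Fin n)
    (ω : Outc X Y Z R0 R n) : ∑ v, stepPMF S A i ω v = 1 := by
  simp only [Fintype.sum_prod_type, stepPMF, ← Finset.mul_sum, (A.adv_pmf _ _ _ _ _).2, mul_one,
    (S.dec_pmf _ _ _ _ _ _).2]

theorem stepPMF_congr (S : Scheme X Y Z R0 R n) (A : Adversary X Y Z R n) (i : Fin n)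
    {ω ω' : Outc X Y Z R0 R n} (hk : ω.2.1 = ω'.2.1) (hj : ω.2.2.1 = ω'.2.2.1)
    (h : ∀ m, m < i → ω.1 m = ω'.1 m ∧ ω.2.2.2.1 m = ω'.2.2.2.1 m ∧
      ω.2.2.2.2 m = ω'.2.2.2.2 m) :
    stepPMF S A i ω = stepPMF S A i ω' := by
  funext v
  rw [stepPMF, stepPMF, hk, hj,
    S.dec_causal i _ _ _ _ _ _ _ _ (fun m hm => (h m hm).1) (fun m hm => (h m hm).2.1)
      (fun m hm => (h m hm).2.2),
    A.adv_causal i _ _ _ _ _ _ _ (fun m hm => (h m hm).1) (fun m hm => (h m hm).2.1)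
      (fun m hm => (h m hm).2.2)]

theorem jointPMF_eq (p0 : X → ℝ) (S : Scheme X Y Z R0 R n) (A : Adversary X Y Z R n)
    (ω : Outc X Y Z R0 R n) :
    jointPMF p0 S A ω = (∏ i, p0 (ω.1 i)) * (keyCard R0 n : ℝ)⁻¹ * S.enc ω.1 ω.2.1 ω.2.2.1 *
      ∏ i, stepPMF S A i ω (ω.2.2.2.1 i, ω.2.2.2.2 i) :=
  rfl

theorem isPMF_jointPMF [hne : Nonempty (Outc X Y Z R0 R n)] {p0 : X → ℝ} (hp0 : IsPMF p0)
    (S : Scheme X Y Z R0 R n) (A : Adversary X Y Z R n) : IsPMF (jointPMF p0 S A) := by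
  constructor
  · intro ω
    rw [jointPMF_eq]
    have := (S.enc_pmf ω.1 ω.2.1).1 ω.2.2.1
    have h1 : 0 ≤ ∏ i, p0 (ω.1 i) := Finset.prod_nonneg fun i _ => hp0.1 _
    have h2 : 0 ≤ ∏ i, stepPMF S A i ω (ω.2.2.2.1 i, ω.2.2.2.2 i) :=
      Finset.prod_nonneg fun i _ => stepPMF_nonneg S A i ω _
    positivity
  · obtain ⟨ω₀⟩ := hne
    have hstep : ∀ x k j, ∑ yz : (Fin n → Y) × (Fin n → Z),
        ∏ i, stepPMF S A i (x, k, j, yz) (yz.1 i, yz.2 i) = 1 := by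
      intro x k j
      rw [← (Equiv.arrowProdEquivProdArrow (Fin n) (fun _ => Y) (fun _ => Z)).sum_comp]
      exact sum_prod_causal_eq_one
        (fun i u => stepPMF S A i (x, k, j, fun m => (u m).1, fun m => (u m).2))
        ⟨fun m => (ω₀.2.2.2.1 m, ω₀.2.2.2.2 m)⟩ (fun i u => sum_stepPMF S A i _)
        (fun i u u' h => stepPMF_congr S A i rfl rfl fun m hm => by simp [h m hm])
    have hx : ∑ x : Fin n → X, ∏ i, p0 (x i) = 1 := by
      rw [← Fintype.piFinset_univ, ← Finset.prod_univ_sum]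
      simp [hp0.2]
    have hK : (keyCard R0 n : ℝ) ≠ 0 := by exact_mod_cast (keyCard_pos R0 n).ne'
    simp only [jointPMF_eq]
    rw [Fintype.sum_prod_type]
    simp only [Fintype.sum_prod_type (α₁ := Fin (keyCard R0 n)),
      Fintype.sum_prod_type (α₁ := Fin (msgCard R n)), ← Finset.mul_sum, hstep, mul_one,
      (S.enc_pmf _ _).2]
    simp [hx, hK]

/-- The entropy of the whole block dominates the cross-entropies of the source, the key and the
channel outputs. -/
theorem le_entropy_history_last [Nonempty (Outc X Y Z R0 R n)] {p0 : X → ℝ} (hp0 : IsPMF p0)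
    (S : Scheme X Y Z R0 R n) (A : Adversary X Y Z R n) :
    (∑ i, ∑ ω, jointPMF p0 S A ω * -Real.logb 2 (p0 (ω.1 i))) + Real.logb 2 (keyCard R0 n) +
        ∑ i, ∑ ω, jointPMF p0 S A ω *
          -Real.logb 2 (stepPMF S A i ω (ω.2.2.2.1 i, ω.2.2.2.2 i)) ≤
      entropy (jointPMF p0 S A) (history n) := by
  have hp := isPMF_jointPMF hp0 S A
  have hid : entropy (jointPMF p0 S A) (history n) = entropy (jointPMF p0 S A) id := by
    refine entropy_congr _ fun ω ω' => ?_
    rw [history_eq_iff]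
    obtain ⟨x, k, j, y, z⟩ := ω
    obtain ⟨x', k', j', y', z'⟩ := ω'
    simp only [id, Prod.mk.injEq, funext_iff, Fin.is_lt, forall_const]
    grind
  have hprob : ∀ ω, probOf (jointPMF p0 S A) id ω = jointPMF p0 S A ω := by
    intro ω
    simp [probOf]
  have hK : Real.logb 2 (keyCard R0 n) =
      ∑ ω, jointPMF p0 S A ω * Real.logb 2 (keyCard R0 n) := by
    rw [← Finset.sum_mul, hp.2, one_mul]
  rw [hid, entropy_eq_sum_neg_logb, hK, Finset.sum_comm,
    Finset.sum_comm (s := Finset.univ (α := Fin n)),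
    ← Finset.sum_add_distrib, ← Finset.sum_add_distrib]
  refine Finset.sum_le_sum fun ω _ => ?_
  simp only [id, hprob, ← Finset.mul_sum, ← mul_add]
  rcases (hp.1 ω).eq_or_lt with h0 | h0
  · simp [← h0]
  refine mul_le_mul_of_nonneg_left ?_ h0.le
  have hne := h0.ne'
  rw [jointPMF_eq] at hne ⊢
  obtain ⟨h3, hstep⟩ := mul_ne_zero_iff.1 hne
  obtain ⟨h2, henc⟩ := mul_ne_zero_iff.1 h3
  obtain ⟨hx, hkey⟩ := mul_ne_zero_iff.1 h2
  have henc_le : Real.logb 2 (S.enc ω.1 ω.2.1 ω.2.2.1) ≤ 0 :=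
    Real.logb_nonpos one_lt_two ((S.enc_pmf _ _).1 _)
      ((Finset.single_le_sum (fun j _ => (S.enc_pmf ω.1 ω.2.1).1 j) (Finset.mem_univ _)).trans_eq
        (S.enc_pmf _ _).2)
  rw [Real.logb_mul h3 hstep, Real.logb_mul h2 henc, Real.logb_mul hx hkey, Real.logb_inv,
    Real.logb_prod _ _ (Finset.prod_ne_zero_iff.1 hx),
    Real.logb_prod _ _ (Finset.prod_ne_zero_iff.1 hstep)]
  simp only [Finset.sum_neg_distrib]
  linarith

theorem stepPMF_pos {p0 : X → ℝ}
    (S : Scheme X Y Z R0 R n) (A : Adversary X Y Z R n) (i : Fin n) (ω : Outc X Y Z R0 R n)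
    (h : 0 < jointPMF p0 S A ω) : 0 < stepPMF S A i ω (ω.2.2.2.1 i, ω.2.2.2.2 i) := by
  rw [jointPMF_eq] at h
  exact (stepPMF_nonneg S A i ω _).lt_of_ne'
    (Finset.prod_ne_zero_iff.1 (mul_ne_zero_iff.1 h.ne').2 i (Finset.mem_univ i))

theorem source_pos {p0 : X → ℝ} (hp0 : IsPMF p0)
    (S : Scheme X Y Z R0 R n) (A : Adversary X Y Z R n) (i : Fin n) (ω : Outc X Y Z R0 R n)
    (h : 0 < jointPMF p0 S A ω) : 0 < p0 (ω.1 i) := by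
  rw [jointPMF_eq, mul_assoc, mul_assoc] at h
  exact (hp0.1 _).lt_of_ne'
    (Finset.prod_ne_zero_iff.1 (mul_ne_zero_iff.1 h.ne').1 i (Finset.mem_univ i))

theorem mutualInfo_past_le [Nonempty (Outc X Y Z R0 R n)] {p0 : X → ℝ} (hp0 : IsPMF p0)
    (S : Scheme X Y Z R0 R n) (A : Adversary X Y Z R n) (i : Fin n) :
    mutualInfo (jointPMF p0 S A) (fun ω => ω.1 i)
        (fun ω => (ω.2.2.1, ω.2.1, pastOf ω.1 i, pastOf ω.2.2.2.1 i, pastOf ω.2.2.2.2 i)) ≤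
      ∑ ω, jointPMF p0 S A ω * -Real.logb 2 (p0 (ω.1 i)) +
        ∑ ω, jointPMF p0 S A ω * -Real.logb 2 (stepPMF S A i ω (ω.2.2.2.1 i, ω.2.2.2.2 i)) -
        (entropy (jointPMF p0 S A) (history (i.1 + 1)) -
          entropy (jointPMF p0 S A) (history i.1)) := by
  have hp := isPMF_jointPMF hp0 S A
  have hx := entropy_le_crossEntropy hp (fun ω => ω.1 i) p0 hp0.1 hp0.2.le
    (source_pos hp0 S A i)
  have hstep := entropy_pair_sub_le hp (fun ω => (ω.1 i, history i.1 ω))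
    (fun ω => (ω.2.2.2.1 i, ω.2.2.2.2 i)) (stepPMF S A i) (stepPMF_nonneg S A i)
    (fun ω => (sum_stepPMF S A i ω).le)
    (fun ω ω' h => by
      obtain ⟨hj, hk, hpast⟩ := (history_eq_iff _ _ _).1 (Prod.mk.inj h).2
      exact stepPMF_congr S A i hk hj hpast)
    (stepPMF_pos S A i)
  rw [← entropy_congr _ (history_succ_eq_iff i)] at hstep
  have hpair : ∀ ω ω' : Outc X Y Z R0 R n,
      (ω.1 i, ω.2.2.1, ω.2.1, pastOf ω.1 i, pastOf ω.2.2.2.1 i, pastOf ω.2.2.2.2 i) =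
          (ω'.1 i, ω'.2.2.1, ω'.2.1, pastOf ω'.1 i, pastOf ω'.2.2.2.1 i, pastOf ω'.2.2.2.2 i) ↔
        (ω.1 i, history i.1 ω) = (ω'.1 i, history i.1 ω') := fun ω ω' => by
    rw [Prod.mk_inj (a₁ := ω.1 i), Prod.mk_inj (a₁ := ω.1 i), pastObservation_eq_iff]
  rw [mutualInfo, entropy_congr _ (pastObservation_eq_iff i),
    entropy_congr (B := fun ω => (ω.1 i, history i.1 ω)) _ hpair]
  linarith

theorem entropy_history_zero_le [Nonempty (Outc X Y Z R0 R n)] {p0 : X → ℝ} (hp0 : IsPMF p0)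
    (S : Scheme X Y Z R0 R n) (A : Adversary X Y Z R n) :
    entropy (jointPMF p0 S A) (history 0) ≤
      entropy (jointPMF p0 S A) (fun ω => ω.2.2.1) + Real.logb 2 (keyCard R0 n) := by
  have : Nonempty (Fin (keyCard R0 n)) := ⟨⟨0, keyCard_pos R0 n⟩⟩
  have h := entropy_pair_le_add_logb_card (isPMF_jointPMF hp0 S A) (fun ω => ω.2.2.1)
    (fun ω => ω.2.1)
  rw [Fintype.card_fin] at h
  rwa [entropy_congr (B := fun ω => (ω.2.2.1, ω.2.1)) _ fun ω ω' => by
    simp [history_eq_iff]]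

theorem entropy_message_le {p0 : X → ℝ} (hp0 : IsPMF p0) (hR : 0 ≤ R)
    (S : Scheme X Y Z R0 R n) (A : Adversary X Y Z R n) :
    entropy (jointPMF p0 S A) (fun ω => ω.2.2.1) ≤ n * R := by
  rcases isEmpty_or_nonempty (Outc X Y Z R0 R n) with hΩ | hΩ
  · rw [entropy_eq_sum_neg_logb, Fintype.sum_empty]
    positivity
  · have : Nonempty (Fin (msgCard R n)) := ⟨⟨0, msgCard_pos R n⟩⟩
    refine (entropy_le_logb_card (isPMF_jointPMF hp0 S A) _).trans ?_
    rw [Fintype.card_fin]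
    exact logb_msgCard_le hR

theorem sum_mutualInfo_past_le_entropy_message {p0 : X → ℝ} (hp0 : IsPMF p0)
    (S : Scheme X Y Z R0 R n) (A : Adversary X Y Z R n) :
    ∑ i : Fin n, mutualInfo (jointPMF p0 S A) (fun ω => ω.1 i)
        (fun ω => (ω.2.2.1, ω.2.1, pastOf ω.1 i, pastOf ω.2.2.2.1 i, pastOf ω.2.2.2.2 i)) ≤
      entropy (jointPMF p0 S A) (fun ω => ω.2.2.1) := by
  rcases isEmpty_or_nonempty (Outc X Y Z R0 R n) with hΩ | hΩ
  · simp [mutualInfo, entropy_eq_sum_neg_logb]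
  · refine (Finset.sum_le_sum fun i _ => mutualInfo_past_le hp0 S A i).trans ?_
    rw [Finset.sum_sub_distrib, Finset.sum_add_distrib,
      Fin.sum_univ_eq_sum_range fun t => entropy (jointPMF p0 S A) (history (t + 1)) -
        entropy (jointPMF p0 S A) (history t),
      Finset.sum_range_sub fun t => entropy (jointPMF p0 S A) (history t)]
    have h1 := le_entropy_history_last hp0 S A
    have h2 := entropy_history_zero_le hp0 S A
    linarith

end Scheme

/-- **Communication-rate converse inequality.**  For any scheme and any adversary strategy,
`H(J) ≥ Σᵢ I(Xᵢ ; J, K, X^{i-1}, Y^{i-1}, Z^{i-1})`, and consequently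
`n R ≥ Σᵢ I(Xᵢ ; J, K, X^{i-1}, Y^{i-1}, Z^{i-1})`. -/
theorem communication_rate_converse
    {X Y Z : Type} [Fintype X] [Fintype Y] [Fintype Z]
    (p0 : X → ℝ) (hp0 : IsPMF p0)
    (R0 R : ℝ) (hR0 : 0 ≤ R0) (hR : 0 ≤ R) (n : ℕ)
    (S : Scheme X Y Z R0 R n) (A : Adversary X Y Z R n) :
    entropy (jointPMF p0 S A) (fun ω => ω.2.2.1) ≥
      ∑ i : Fin n, mutualInfo (jointPMF p0 S A)
        (fun ω => ω.1 i)
        (fun ω => (ω.2.2.1, ω.2.1, pastOf ω.1 i, pastOf ω.2.2.2.1 i, pastOf ω.2.2.2.2 i)) ∧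
    (n : ℝ) * R ≥
      ∑ i : Fin n, mutualInfo (jointPMF p0 S A)
        (fun ω => ω.1 i)
        (fun ω => (ω.2.2.1, ω.2.1, pastOf ω.1 i, pastOf ω.2.2.2.1 i, pastOf ω.2.2.2.2 i)) := by
  have h := sum_mutualInfo_past_le_entropy_message hp0 S A
  exact ⟨h, h.trans (entropy_message_le hp0 hR S A)⟩

end
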